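/- arXiv:2003.06493 — 3 statements merged into one kernel-verified Lean document; each statement's English description precedes it below -/
import Mathlib

section
/- Let S and M be finite index sets and n, q, p positive integers. For each i ∈ S let A_i be a real n×n matrix, B_i a real n×q matrix, and D_i a real n×p matrix; for each i, j ∈ S and m ∈ M let γ_ij^m be real numbers with γ_ij^m ≥ 0 whenever j ≠ i. Suppose there exist real symmetric positive definite n×n matrices X_i (i ∈ S), real q×n matrices Y_i^m (i ∈ S, m ∈ M), and reals κ_i > 0 (i ∈ S) such that for every i ∈ S and m ∈ M the matrix X_i A_iᵀ + (Y_i^m)ᵀ B_iᵀ + A_i X_i + B_i Y_i^m + γ_ii^m X_i + X_i·(Σ_{j ∈ S\{i}} γ_ij^m · X_j⁻¹)·X_i + (1/κ_i)·D_i D_iᵀ is negative definite. Then, setting P_i := X_i⁻¹ and Ḡ_i^m := Y_i^m X_i⁻¹, for every i ∈ S and m ∈ M the matrix Ψ_i^m := P_i(A_i + B_i Ḡ_i^m) + (A_i + B_i Ḡ_i^m)ᵀ P_i + Σ_{j∈S} γ_ij^m · P_j + (1/κ_i)·P_i D_i D_iᵀ P_i is negative definite. -/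
open Matrix

/-- A real matrix is negative definite if its quadratic form is negative on nonzero vectors. -/
def NegDef {m : Type*} [Fintype m] (M : Matrix m m ℝ) : Prop :=
  ∀ x : m → ℝ, x ≠ 0 → x ⬝ᵥ (M *ᵥ x) < 0

/-- Feasibility of the LMIs (11) implies that, with `P_i = X_i⁻¹` and
`Ḡ_i^m = Y_i^m X_i⁻¹`, every Lyapunov dissipation matrix
`Ψ_i^m = P_i(A_i + B_i Ḡ_i^m) + (A_i + B_i Ḡ_i^m)ᵀ P_i + Σ_j γ_ij^m P_j
 + (1/κ_i) P_i D_i D_iᵀ P_i` is negative definite. -/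
theorem LMI_implies_Psi_negdef
    (S M : Type) [Fintype S] [Fintype M] [DecidableEq S]
    (n q p : ℕ) (hn : 0 < n) (hq : 0 < q) (hp : 0 < p)
    (A : S → Matrix (Fin n) (Fin n) ℝ) (B : S → Matrix (Fin n) (Fin q) ℝ)
    (D : S → Matrix (Fin n) (Fin p) ℝ)
    (γ : S → S → M → ℝ) (hγ : ∀ i j m, j ≠ i → 0 ≤ γ i j m)
    (X : S → Matrix (Fin n) (Fin n) ℝ) (hX : ∀ i, (X i).PosDef)
    (Y : S → M → Matrix (Fin q) (Fin n) ℝ)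
    (κ : S → ℝ) (hκ : ∀ i, 0 < κ i)
    (hLMI : ∀ i m, NegDef
      (X i * (A i)ᵀ + (Y i m)ᵀ * (B i)ᵀ + A i * X i + B i * Y i m + γ i i m • X i +
        X i * (∑ j ∈ Finset.univ.erase i, γ i j m • (X j)⁻¹) * X i +
        (1 / κ i) • (D i * (D i)ᵀ))) :
    ∀ i m,
      NegDef
        ((X i)⁻¹ * (A i + B i * (Y i m * (X i)⁻¹)) +
          (A i + B i * (Y i m * (X i)⁻¹))ᵀ * (X i)⁻¹ +
          ∑ j : S, γ i j m • (X j)⁻¹ +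
          (1 / κ i) • ((X i)⁻¹ * D i * (D i)ᵀ * (X i)⁻¹)) := by
  intro i m x hx
  have hdet : IsUnit (X i).det := (Matrix.isUnit_iff_isUnit_det _).1 (hX i).isUnit
  have h1 : (X i)⁻¹ * X i = 1 := Matrix.nonsing_inv_mul _ hdet
  have h2 : X i * (X i)⁻¹ = 1 := Matrix.mul_nonsing_inv _ hdet
  have hP : ((X i)⁻¹)ᵀ = (X i)⁻¹ := by
    have h := (hX i).inv.isHermitian.eq
    rwa [Matrix.conjTranspose_eq_transpose_of_trivial] at h
  rw [← Finset.add_sum_erase Finset.univ (fun j => γ i j m • (X j)⁻¹) (Finset.mem_univ i)]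
  have hL := hLMI i m
  generalize (∑ j ∈ Finset.univ.erase i, γ i j m • (X j)⁻¹) = T at hL ⊢
  simp only [Matrix.transpose_add, Matrix.transpose_mul, hP]
  generalize (X i)⁻¹ = P at h1 h2 hP ⊢
  have h1' : ∀ {k : ℕ} (Z : Matrix (Fin n) (Fin k) ℝ), P * (X i * Z) = Z := fun Z => by
    rw [← Matrix.mul_assoc, h1, Matrix.one_mul]
  have h2' : ∀ {k : ℕ} (Z : Matrix (Fin n) (Fin k) ℝ), X i * (P * Z) = Z := fun Z => by
    rw [← Matrix.mul_assoc, h2, Matrix.one_mul]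
  have hne : P *ᵥ x ≠ 0 := by
    intro h0
    apply hx
    have h := congrArg (fun v => X i *ᵥ v) h0
    simpa [Matrix.mulVec_mulVec, h2] using h
  have hneg := hL (P *ᵥ x) hne
  have key : ∀ L : Matrix (Fin n) (Fin n) ℝ,
      (P *ᵥ x) ⬝ᵥ (L *ᵥ (P *ᵥ x)) = x ⬝ᵥ ((P * L * P) *ᵥ x) := by
    intro L
    have hv : P *ᵥ x = x ᵥ* P := by
      conv_lhs => rw [← hP, Matrix.mulVec_transpose]
    rw [← Matrix.mulVec_mulVec, ← Matrix.mulVec_mulVec, Matrix.dotProduct_mulVec x P, ← hv]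
  rw [key] at hneg
  convert hneg using 3
  simp only [Matrix.mul_add, Matrix.add_mul, Matrix.mul_assoc, Matrix.mul_smul,
    Matrix.smul_mul, h1, h2, h1', Matrix.mul_one, Matrix.one_mul]
  abel
end

section
/- Let S and M be finite index sets and n, q, p positive integers. For each i ∈ S let A_i be a real n×n matrix, B_i a real n×q matrix, and D_i a real n×p matrix; for each i, j ∈ S and m ∈ M let γ_ij^m be real numbers with γ_ij^m ≥ 0 whenever j ≠ i. Suppose there exist real symmetric positive definite n×n matrices X_i (i ∈ S), real q×n matrices Y_i (i ∈ S, independent of m), and reals κ_i > 0 such that for every i ∈ S and m ∈ M the matrix X_i A_iᵀ + Y_iᵀ B_iᵀ + A_i X_i + B_i Y_i + γ_ii^m X_i + X_i·(Σ_{j ∈ S\{i}} γ_ij^m · X_j⁻¹)·X_i + (1/κ_i)·D_i D_iᵀ is negative definite. Then, setting P_i := X_i⁻¹ and G̃_i := Y_i X_i⁻¹, for every i ∈ S and m ∈ M the matrix P_i(A_i + B_i G̃_i) + (A_i + B_i G̃_i)ᵀ P_i + Σ_{j∈S} γ_ij^m · P_j + (1/κ_i)·P_i D_i D_iᵀ P_i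 is negative definite. -/
open Matrix

/-- Full-information case (Proposition 1): with gains `G̃_i = Y_i X_i⁻¹`
independent of `m`, feasibility of the LMIs implies each closed-loop dissipation matrix
is negative definite. -/
theorem LMI_implies_Psi_negdef_full_info
    (S M : Type) [Fintype S] [Fintype M] [DecidableEq S]
    (n q p : ℕ) (hn : 0 < n) (hq : 0 < q) (hp : 0 < p)
    (A : S → Matrix (Fin n) (Fin n) ℝ) (B : S → Matrix (Fin n) (Fin q) ℝ)
    (D : S → Matrix (Fin n) (Fin p) ℝ)
    (γ : S → S → M → ℝ) (hγ : ∀ i j m, j ≠ i → 0 ≤ γ i j m)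
    (X : S → Matrix (Fin n) (Fin n) ℝ) (hX : ∀ i, (X i).PosDef)
    (Y : S → Matrix (Fin q) (Fin n) ℝ)
    (κ : S → ℝ) (hκ : ∀ i, 0 < κ i)
    (hLMI : ∀ i m, NegDef
      (X i * (A i)ᵀ + (Y i)ᵀ * (B i)ᵀ + A i * X i + B i * Y i + γ i i m • X i +
        X i * (∑ j ∈ Finset.univ.erase i, γ i j m • (X j)⁻¹) * X i +
        (1 / κ i) • (D i * (D i)ᵀ))) :
    ∀ i m,
      NegDef
        ((X i)⁻¹ * (A i + B i * (Y i * (X i)⁻¹)) +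
          (A i + B i * (Y i * (X i)⁻¹))ᵀ * (X i)⁻¹ +
          ∑ j : S, γ i j m • (X j)⁻¹ +
          (1 / κ i) • ((X i)⁻¹ * D i * (D i)ᵀ * (X i)⁻¹)) := by
  intro i m x hx
  have hu : IsUnit (X i).det := (Matrix.isUnit_iff_isUnit_det _).1 (hX i).isUnit
  have h1 : X i * (X i)⁻¹ = 1 := Matrix.mul_nonsing_inv _ hu
  have h2 : (X i)⁻¹ * X i = 1 := Matrix.nonsing_inv_mul _ hu
  have hs : ((X i)⁻¹)ᵀ = (X i)⁻¹ := by
    have := (hX i).inv.1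
    rwa [Matrix.IsHermitian, Matrix.conjTranspose_eq_transpose_of_trivial] at this
  have hL := hLMI i m ((X i)⁻¹ *ᵥ x) (by
    intro h0
    apply hx
    have := congrArg (fun v => X i *ᵥ v) h0
    simpa [Matrix.mulVec_mulVec, h1] using this)
  rw [← Finset.add_sum_erase Finset.univ (fun j => γ i j m • (X j)⁻¹) (Finset.mem_univ i)]
  generalize (∑ j ∈ Finset.univ.erase i, γ i j m • (X j)⁻¹) = T at hL ⊢
  generalize (X i)⁻¹ = P at *
  have key : P * (A i + B i * (Y i * P)) + (A i + B i * (Y i * P))ᵀ * P +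
      (γ i i m • P + T) + (1 / κ i) • (P * D i * (D i)ᵀ * P) =
      P * (X i * (A i)ᵀ + (Y i)ᵀ * (B i)ᵀ + A i * X i + B i * Y i + γ i i m • X i +
        X i * T * X i + (1 / κ i) • (D i * (D i)ᵀ)) * P := by
    have e1 : P * (X i * (A i)ᵀ) * P = (A i)ᵀ * P := by
      rw [← Matrix.mul_assoc P, h2, Matrix.one_mul]
    have e2 : P * (A i * X i) * P = P * A i := by
      rw [Matrix.mul_assoc, Matrix.mul_assoc, h1, Matrix.mul_one]
    have e3 : P * X i * P = P := by rw [h2, Matrix.one_mul]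
    have e4 : P * (X i * T * X i) * P = T := by
      rw [Matrix.mul_assoc, Matrix.mul_assoc (X i * T), h1, Matrix.mul_one,
        ← Matrix.mul_assoc, h2, Matrix.one_mul]
    simp only [Matrix.mul_add, Matrix.add_mul, e1, e2, e4, Matrix.mul_smul, Matrix.smul_mul, e3,
      Matrix.transpose_add, Matrix.transpose_mul, hs]
    simp only [Matrix.mul_assoc]
    abel
  rw [key]
  have e : ∀ L : Matrix (Fin n) (Fin n) ℝ,
      x ⬝ᵥ ((P * L * P) *ᵥ x) = (P *ᵥ x) ⬝ᵥ (L *ᵥ (P *ᵥ x)) := by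
    intro L
    rw [Matrix.mul_assoc, ← Matrix.mulVec_mulVec, ← Matrix.mulVec_mulVec,
      Matrix.dotProduct_mulVec x P, ← Matrix.mulVec_transpose, hs]
  rw [e]
  exact hL
end

section
/- Let S₁, S₂, M₁, M₂ be finite index sets and n₁, n₂, q₁, q₂, p₁, p₂ positive integers. For k ∈ {1,2} and each i_k ∈ S_k, let A_{k,i_k} be a real n_k×n_k matrix, B_{k,i_k} a real n_k×q_k matrix, and D_{k,i_k} a real n_k×p_k matrix. For i₁, j₁ ∈ S₁ and m₂ ∈ M₂ let λ_{i₁j₁}^{m₂} ∈ ℝ with λ_{i₁j₁}^{m₂} ≥ 0 whenever j₁ ≠ i₁; for i₂, j₂ ∈ S₂ and m₁ ∈ M₁ let μ_{i₂j₂}^{m₁} ∈ ℝ with μ_{i₂j₂}^{m₁} ≥ 0 whenever j₂ ≠ i₂. Suppose there exist real symmetric positive definite matrices X_{1,i₁}, X_{2,i₂}, real matrices Y_{1,i₁}^{m₁,m₂} (q₁×n₁) and Y_{2,i₂}^{m₁,m₂} (q₂×n₂), and reals κ_{1,i₁} > 0, κ_{2,i₂} > 0 such that for all i₁ ∈ S₁,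 i₂ ∈ S₂, m₁ ∈ M₁, m₂ ∈ M₂: (i) X_{1,i₁}A_{1,i₁}ᵀ + (Y_{1,i₁}^{m₁,m₂})ᵀB_{1,i₁}ᵀ + A_{1,i₁}X_{1,i₁} + B_{1,i₁}Y_{1,i₁}^{m₁,m₂} + λ_{i₁i₁}^{m₂}X_{1,i₁} + X_{1,i₁}(Σ_{j₁≠i₁} λ_{i₁j₁}^{m₂}·X_{1,j₁}⁻¹)X_{1,i₁} + (1/κ_{1,i₁})D_{1,i₁}D_{1,i₁}ᵀ is negative definite, and (ii) the analogous matrix for system 2 with A_{2,i₂}, B_{2,i₂}, Y_{2,i₂}^{m₁,m₂}, μ_{i₂j₂}^{m₁}, D_{2,i₂}, κ_{2,i₂} is negative definite. Then, setting P_{k,i_k} := X_{k,i_k}⁻¹ and Ḡ_{k,i_k}^{m₁,m₂} := Y_{k,i_k}^{m₁,m₂}X_{k,i_k}⁻¹, for every i₁ ∈ S₁, i₂ ∈ S₂, m₁ ∈ M₁, m₂ ∈ M₂ the block-diagonal matrix diag(Ψ_{1,i₁}^{m₁,m₂}, Ψ_{2,i₂}^{m₁,m₂}) is negative definite, where Ψ_{1,i₁}^{m₁,m₂}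 := P_{1,i₁}(A_{1,i₁}+B_{1,i₁}Ḡ_{1,i₁}^{m₁,m₂}) + (A_{1,i₁}+B_{1,i₁}Ḡ_{1,i₁}^{m₁,m₂})ᵀP_{1,i₁} + Σ_{j₁∈S₁} λ_{i₁j₁}^{m₂}·P_{1,j₁} + (1/κ_{1,i₁})P_{1,i₁}D_{1,i₁}D_{1,i₁}ᵀP_{1,i₁}, and Ψ_{2,i₂}^{m₁,m₂} is defined analogously with μ_{i₂j₂}^{m₁}. -/
open Matrix

lemma negDef_single {S : Type} [Fintype S] [DecidableEq S] {n q p : ℕ}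
    (A : Matrix (Fin n) (Fin n) ℝ) (B : Matrix (Fin n) (Fin q) ℝ) (D : Matrix (Fin n) (Fin p) ℝ)
    (l : S → ℝ) (X : S → Matrix (Fin n) (Fin n) ℝ) (i : S) (hX : (X i).PosDef)
    (Y : Matrix (Fin q) (Fin n) ℝ) (c : ℝ)
    (h : NegDef (X i * Aᵀ + Yᵀ * Bᵀ + A * X i + B * Y + l i • X i +
        X i * (∑ j ∈ Finset.univ.erase i, l j • (X j)⁻¹) * X i + c • (D * Dᵀ))) :
    NegDef ((X i)⁻¹ * (A + B * (Y * (X i)⁻¹)) + (A + B * (Y * (X i)⁻¹))ᵀ * (X i)⁻¹ +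
      (∑ j : S, l j • (X j)⁻¹) + c • ((X i)⁻¹ * D * Dᵀ * (X i)⁻¹)) := by
  have hu : IsUnit (X i).det := (Matrix.isUnit_iff_isUnit_det _).1 hX.isUnit
  have hT : ((X i)⁻¹)ᵀ = (X i)⁻¹ := by
    have := hX.isHermitian.inv
    simpa [Matrix.IsHermitian, Matrix.conjTranspose_eq_transpose_of_trivial] using this
  rw [← Finset.add_sum_erase Finset.univ (fun j => l j • (X j)⁻¹) (Finset.mem_univ i)]
  generalize (∑ j ∈ Finset.univ.erase i, l j • (X j)⁻¹) = T at *
  generalize X i = Z at *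
  have h1 : Z⁻¹ * Z = 1 := Matrix.nonsing_inv_mul _ hu
  have h2 : Z * Z⁻¹ = 1 := Matrix.mul_nonsing_inv _ hu
  have h1' : ∀ W : Matrix (Fin n) (Fin n) ℝ, Z⁻¹ * (Z * W) = W := fun W => by
    rw [← Matrix.mul_assoc, h1, Matrix.one_mul]
  have key : Z⁻¹ * (A + B * (Y * Z⁻¹)) + (A + B * (Y * Z⁻¹))ᵀ * Z⁻¹ +
      (l i • Z⁻¹ + T) + c • (Z⁻¹ * D * Dᵀ * Z⁻¹) =
      Z⁻¹ * (Z * Aᵀ + Yᵀ * Bᵀ + A * Z + B * Y + l i • Z + Z * T * Z + c • (D * Dᵀ)) * Z⁻¹ := by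
    simp only [Matrix.mul_add, Matrix.add_mul, Matrix.transpose_add, Matrix.transpose_mul, hT,
      Matrix.mul_assoc, h1', h2, Matrix.mul_one, Matrix.mul_smul, Matrix.smul_mul]
    abel
  rw [key]
  intro x hx
  have hne : Z⁻¹ *ᵥ x ≠ 0 := by
    intro h0
    apply hx
    have := congrArg (fun v => Z *ᵥ v) h0
    simpa [Matrix.mulVec_mulVec, h2] using this
  have := h _ hne
  rw [← Matrix.mulVec_mulVec, ← Matrix.mulVec_mulVec, Matrix.dotProduct_mulVec x,
    ← Matrix.mulVec_transpose, hT]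
  exact this

lemma negDef_fromBlocks {m n : Type*} [Fintype m] [Fintype n] {P : Matrix m m ℝ}
    {Q : Matrix n n ℝ} (hP : NegDef P) (hQ : NegDef Q) :
    NegDef (Matrix.fromBlocks P 0 0 Q) := by
  intro x hx
  have e : x ⬝ᵥ (Matrix.fromBlocks P 0 0 Q *ᵥ x) =
      (x ∘ Sum.inl) ⬝ᵥ (P *ᵥ (x ∘ Sum.inl)) + (x ∘ Sum.inr) ⬝ᵥ (Q *ᵥ (x ∘ Sum.inr)) := by
    rw [Matrix.fromBlocks_mulVec]
    simp [dotProduct, Fintype.sum_sum_type]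
  rw [e]
  by_cases h1 : x ∘ Sum.inl = 0
  · have h2 : x ∘ Sum.inr ≠ 0 := by
      intro h2
      apply hx
      ext k
      rcases k with k | k
      · exact congrFun h1 k
      · exact congrFun h2 k
    have := hQ _ h2
    rw [h1]
    simpa using this
  · have a := hP _ h1
    by_cases h2 : x ∘ Sum.inr = 0
    · rw [h2]
      simpa using a
    · have := hQ _ h2
      linarith

/-- Distributed LMI feasibility for the two interdependent systems implies
that the block-diagonal integrated Lyapunov dissipation matrix
`diag(Ψ_{1,i₁}^{m₁,m₂}, Ψ_{2,i₂}^{m₁,m₂})` is negative definite, where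
`P_{k,i} = X_{k,i}⁻¹` and `Ḡ_{k,i}^{m₁,m₂} = Y_{k,i}^{m₁,m₂} X_{k,i}⁻¹`. -/
theorem distributed_LMI_implies_integrated_negdef
    (S₁ S₂ M₁ M₂ : Type) [Fintype S₁] [Fintype S₂] [Fintype M₁] [Fintype M₂]
    [DecidableEq S₁] [DecidableEq S₂]
    (n₁ n₂ q₁ q₂ p₁ p₂ : ℕ)
    (hn₁ : 0 < n₁) (hn₂ : 0 < n₂) (hq₁ : 0 < q₁) (hq₂ : 0 < q₂) (hp₁ : 0 < p₁) (hp₂ : 0 < p₂)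
    (A₁ : S₁ → Matrix (Fin n₁) (Fin n₁) ℝ) (B₁ : S₁ → Matrix (Fin n₁) (Fin q₁) ℝ)
    (D₁ : S₁ → Matrix (Fin n₁) (Fin p₁) ℝ)
    (A₂ : S₂ → Matrix (Fin n₂) (Fin n₂) ℝ) (B₂ : S₂ → Matrix (Fin n₂) (Fin q₂) ℝ)
    (D₂ : S₂ → Matrix (Fin n₂) (Fin p₂) ℝ)
    (lam : S₁ → S₁ → M₂ → ℝ) (hlam : ∀ i₁ j₁ m₂, j₁ ≠ i₁ → 0 ≤ lam i₁ j₁ m₂)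
    (mu : S₂ → S₂ → M₁ → ℝ) (hmu : ∀ i₂ j₂ m₁, j₂ ≠ i₂ → 0 ≤ mu i₂ j₂ m₁)
    (X₁ : S₁ → Matrix (Fin n₁) (Fin n₁) ℝ) (hX₁ : ∀ i₁, (X₁ i₁).PosDef)
    (X₂ : S₂ → Matrix (Fin n₂) (Fin n₂) ℝ) (hX₂ : ∀ i₂, (X₂ i₂).PosDef)
    (Y₁ : S₁ → M₁ → M₂ → Matrix (Fin q₁) (Fin n₁) ℝ)
    (Y₂ : S₂ → M₁ → M₂ → Matrix (Fin q₂) (Fin n₂) ℝ)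
    (κ₁ : S₁ → ℝ) (hκ₁ : ∀ i₁, 0 < κ₁ i₁)
    (κ₂ : S₂ → ℝ) (hκ₂ : ∀ i₂, 0 < κ₂ i₂)
    (hLMI₁ : ∀ (i₁ : S₁) (m₁ : M₁) (m₂ : M₂), NegDef
      (X₁ i₁ * (A₁ i₁)ᵀ + (Y₁ i₁ m₁ m₂)ᵀ * (B₁ i₁)ᵀ + A₁ i₁ * X₁ i₁ + B₁ i₁ * Y₁ i₁ m₁ m₂ +
        lam i₁ i₁ m₂ • X₁ i₁ +
        X₁ i₁ * (∑ j₁ ∈ Finset.univ.erase i₁, lam i₁ j₁ m₂ • (X₁ j₁)⁻¹) * X₁ i₁ +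
        (1 / κ₁ i₁) • (D₁ i₁ * (D₁ i₁)ᵀ)))
    (hLMI₂ : ∀ (i₂ : S₂) (m₁ : M₁) (m₂ : M₂), NegDef
      (X₂ i₂ * (A₂ i₂)ᵀ + (Y₂ i₂ m₁ m₂)ᵀ * (B₂ i₂)ᵀ + A₂ i₂ * X₂ i₂ + B₂ i₂ * Y₂ i₂ m₁ m₂ +
        mu i₂ i₂ m₁ • X₂ i₂ +
        X₂ i₂ * (∑ j₂ ∈ Finset.univ.erase i₂, mu i₂ j₂ m₁ • (X₂ j₂)⁻¹) * X₂ i₂ +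
        (1 / κ₂ i₂) • (D₂ i₂ * (D₂ i₂)ᵀ))) :
    ∀ (i₁ : S₁) (i₂ : S₂) (m₁ : M₁) (m₂ : M₂),
      NegDef
        (Matrix.fromBlocks
          ((X₁ i₁)⁻¹ * (A₁ i₁ + B₁ i₁ * (Y₁ i₁ m₁ m₂ * (X₁ i₁)⁻¹)) +
            (A₁ i₁ + B₁ i₁ * (Y₁ i₁ m₁ m₂ * (X₁ i₁)⁻¹))ᵀ * (X₁ i₁)⁻¹ +
            (∑ j₁ : S₁, lam i₁ j₁ m₂ • (X₁ j₁)⁻¹) +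
            (1 / κ₁ i₁) • ((X₁ i₁)⁻¹ * D₁ i₁ * (D₁ i₁)ᵀ * (X₁ i₁)⁻¹))
          0 0
          ((X₂ i₂)⁻¹ * (A₂ i₂ + B₂ i₂ * (Y₂ i₂ m₁ m₂ * (X₂ i₂)⁻¹)) +
            (A₂ i₂ + B₂ i₂ * (Y₂ i₂ m₁ m₂ * (X₂ i₂)⁻¹))ᵀ * (X₂ i₂)⁻¹ +
            (∑ j₂ : S₂, mu i₂ j₂ m₁ • (X₂ j₂)⁻¹) +
            (1 / κ₂ i₂) • ((X₂ i₂)⁻¹ * D₂ i₂ * (D₂ i₂)ᵀ * (X₂ i₂)⁻¹))) := by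
  intro i₁ i₂ m₁ m₂
  exact negDef_fromBlocks
    (negDef_single (A₁ i₁) (B₁ i₁) (D₁ i₁) (fun j => lam i₁ j m₂) X₁ i₁ (hX₁ i₁)
      (Y₁ i₁ m₁ m₂) (1 / κ₁ i₁) (hLMI₁ i₁ m₁ m₂))
    (negDef_single (A₂ i₂) (B₂ i₂) (D₂ i₂) (fun j => mu i₂ j m₁) X₂ i₂ (hX₂ i₂)
      (Y₂ i₂ m₁ m₂) (1 / κ₂ i₂) (hLMI₂ i₂ m₁ m₂))
end
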